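/- Let n ≥ 3, 0 ≤ l < k ≤ n, and let A = diag(a₁,…,aₙ) be a diagonal positive definite matrix with σ_k(a) = σ_l(a), where a = (a₁,…,aₙ). Let w(x) = f(½xᵀAx) with f of class C², and let x ∈ ℝⁿ with s := ½xᵀAx. If f'(s) > 0, f''(s) ≤ 0, σ_k(λ(D²w(x))) ≥ 0 and σ_l(λ(D²w(x))) > 0, then σ_k(λ(D²w(x)))/σ_l(λ(D²w(x))) ≥ (f'(s))^{k−l} + 2H_k(A) f''(s)(f'(s))^{k−l−1} s. -/

import Mathlib

open scoped BigOperators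
open Filter MeasureTheory

noncomputable section

/-- The `j`-th elementary symmetric function of `lam ∈ ℝⁿ`. -/
def esym (n j : ℕ) (lam : Fin n → ℝ) : ℝ :=
  ∑ S ∈ Finset.powersetCard j (Finset.univ : Finset (Fin n)), ∏ i ∈ S, lam i

/-- `σ_{j;i}`: the `j`-th elementary symmetric function with the `i`-th variable set to `0`. -/
def esymRem (n j : ℕ) (lam : Fin n → ℝ) (i : Fin n) : ℝ :=
  esym n j (Function.update lam i 0)

/-- The increasingly ordered eigenvalue vector of a real symmetric matrix
(junk value `0` if the matrix is not symmetric). -/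
def eigs {n : ℕ} (M : Matrix (Fin n) (Fin n) ℝ) : Fin n → ℝ :=
  if h : M.IsHermitian then h.eigenvalues ∘ (Tuple.sort h.eigenvalues) else 0

/-- The Hessian matrix `D²u(x)` of `u : ℝⁿ → ℝ`. -/
def hessianMatrix {n : ℕ} (u : EuclideanSpace ℝ (Fin n) → ℝ) (x : EuclideanSpace ℝ (Fin n)) :
    Matrix (Fin n) (Fin n) ℝ :=
  fun i j =>
    fderiv ℝ (fun y => fderiv ℝ u y (EuclideanSpace.single j 1)) x (EuclideanSpace.single i 1)

/-- The quadratic form `½ xᵀ A x`. -/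
def quadForm {n : ℕ} (A : Matrix (Fin n) (Fin n) ℝ) (x : EuclideanSpace ℝ (Fin n)) : ℝ :=
  (1 / 2) * ∑ i, ∑ j, A i j * x i * x j

/-- The Gårding cone `Γ_k = {λ : σ_j(λ) > 0, 1 ≤ j ≤ k}`. -/
def GammaK (n k : ℕ) : Set (Fin n → ℝ) :=
  {lam | ∀ j, 1 ≤ j → j ≤ k → 0 < esym n j lam}

/-- The Hessian quotient operator `S_{k,l}(M) = σ_k(λ(M))/σ_l(λ(M))`. -/
def Skl (n k l : ℕ) (M : Matrix (Fin n) (Fin n) ℝ) : ℝ :=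
  esym n k (eigs M) / esym n l (eigs M)

/-- `H_k(A) = max_i σ_{k-1;i}(λ(A)) λ_i(A) / σ_k(λ(A))`. -/
def Hk (n k : ℕ) (A : Matrix (Fin n) (Fin n) ℝ) : ℝ :=
  ⨆ i : Fin n, esymRem n (k - 1) (eigs A) i * eigs A i / esym n k (eigs A)

/-- `ψ` is admissible on the open set `A` with respect to the cone `Γ`:
it is `C²` on `A` and `λ(D²ψ) ∈ Γ` there. -/
def Admissible {n : ℕ} (Γ : Set (Fin n → ℝ)) (A : Set (EuclideanSpace ℝ (Fin n)))
    (ψ : EuclideanSpace ℝ (Fin n) → ℝ) : Prop :=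
  ContDiffOn ℝ 2 ψ A ∧ ∀ x ∈ A, eigs (hessianMatrix ψ x) ∈ Γ

/-- Viscosity subsolution of `F(D²u) = g` on `Ω` (for `F` of the form `f(λ(D²u))`). -/
def ViscSubsolution {n : ℕ} (Γ : Set (Fin n → ℝ)) (F : Matrix (Fin n) (Fin n) ℝ → ℝ)
    (g : EuclideanSpace ℝ (Fin n) → ℝ) (Ω : Set (EuclideanSpace ℝ (Fin n)))
    (u : EuclideanSpace ℝ (Fin n) → ℝ) : Prop :=
  UpperSemicontinuousOn u Ω ∧
    ∀ Aset : Set (EuclideanSpace ℝ (Fin n)), Aset ⊆ Ω → IsOpen Aset →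
      ∀ ψ : EuclideanSpace ℝ (Fin n) → ℝ, Admissible Γ Aset ψ →
        ∀ x₀ ∈ Aset, IsLocalMaxOn (fun y => u y - ψ y) Aset x₀ →
          g x₀ ≤ F (hessianMatrix ψ x₀)

/-- Viscosity supersolution of `F(D²u) = g` on `Ω`. -/
def ViscSupersolution {n : ℕ} (Γ : Set (Fin n → ℝ)) (F : Matrix (Fin n) (Fin n) ℝ → ℝ)
    (g : EuclideanSpace ℝ (Fin n) → ℝ) (Ω : Set (EuclideanSpace ℝ (Fin n)))
    (u : EuclideanSpace ℝ (Fin n) → ℝ) : Prop :=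
  LowerSemicontinuousOn u Ω ∧
    ∀ Aset : Set (EuclideanSpace ℝ (Fin n)), Aset ⊆ Ω → IsOpen Aset →
      ∀ ψ : EuclideanSpace ℝ (Fin n) → ℝ, Admissible Γ Aset ψ →
        ∀ x₀ ∈ Aset, IsLocalMinOn (fun y => u y - ψ y) Aset x₀ →
          F (hessianMatrix ψ x₀) ≤ g x₀

end

lemma eigs_eq_eigenvalues_comp_sort {n : ℕ} {M : Matrix (Fin n) (Fin n) ℝ} (hM : M.IsHermitian) :
    eigs M = hM.eigenvalues ∘ Tuple.sort hM.eigenvalues := by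
  rw [eigs, dif_pos hM]

open Polynomial in
lemma prod_X_sub_C_eigs {n : ℕ} {M : Matrix (Fin n) (Fin n) ℝ} (hM : M.IsHermitian) :
    ∏ i, (X - C (eigs M i)) = M.charpoly := by
  rw [hM.charpoly_eq, eigs_eq_eigenvalues_comp_sort hM]
  exact Equiv.prod_comp (Tuple.sort hM.eigenvalues) fun i => X - C (hM.eigenvalues i)

lemma prod_add_eigs {n : ℕ} {M : Matrix (Fin n) (Fin n) ℝ} (hM : M.IsHermitian) (t : ℝ) :
    ∏ i, (t + eigs M i) = (Matrix.diagonal (fun _ => t) + M).det := by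
  have h := congrArg (Polynomial.eval (-t)) (prod_X_sub_C_eigs hM)
  rw [Matrix.eval_charpoly, Polynomial.eval_prod] at h
  have h1 : Matrix.scalar (Fin n) (-t) - M = -(Matrix.diagonal (fun _ => t) + M) := by
    ext i j
    by_cases hij : i = j
    · simp [hij]
      ring
    · simp [hij]
  have h2 : ∏ i, (Polynomial.X - Polynomial.C (eigs M i)).eval (-t)
      = (-1) ^ n * ∏ i, (t + eigs M i) := by
    have : ∀ i, (Polynomial.X - Polynomial.C (eigs M i)).eval (-t) = -1 * (t + eigs M i) := by
      intro i
      simp only [Polynomial.eval_sub, Polynomial.eval_X, Polynomial.eval_C]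
      ring
    simp only [this, Finset.prod_mul_distrib]
    simp
  rw [h1, h2, Matrix.det_neg, Fintype.card_fin] at h
  exact mul_left_cancel₀ (pow_ne_zero n (by norm_num)) h

lemma det_diagonal_add_smul_vecMulVec {n : ℕ} (b v : Fin n → ℝ) (c : ℝ) (hb : ∀ i, b i ≠ 0) :
    (Matrix.diagonal b + c • Matrix.vecMulVec v v).det
      = ∏ i, b i + c * ∑ i, v i ^ 2 * ∏ j ∈ Finset.univ.erase i, b j := by
  have hdet : (Matrix.diagonal b).det = ∏ i, b i := Matrix.det_diagonal
  have hu : IsUnit (Matrix.diagonal b).det := by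
    rw [hdet]
    exact (Finset.prod_ne_zero_iff.mpr fun i _ => hb i).isUnit
  have hfac : Matrix.diagonal b + c • Matrix.vecMulVec v v
      = Matrix.diagonal b *
        (1 + Matrix.replicateCol Unit (fun i => c * v i / b i) * Matrix.replicateRow Unit v) := by
    ext i j
    have := hb i
    rw [Matrix.mul_add, Matrix.mul_one, Matrix.add_apply, Matrix.add_apply, Matrix.diagonal_mul,
      Matrix.smul_apply, Matrix.vecMulVec_apply, Matrix.mul_apply]
    simp only [Matrix.replicateCol_apply, Matrix.replicateRow_apply, Finset.univ_unique,
      Finset.sum_singleton, smul_eq_mul]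
    field_simp
  rw [hfac, Matrix.det_mul, Matrix.det_one_add_replicateCol_mul_replicateRow, hdet, mul_add,
    mul_one, dotProduct, Finset.mul_sum, Finset.mul_sum]
  congr 1
  refine Finset.sum_congr rfl fun i _ => ?_
  rw [← Finset.mul_prod_erase _ _ (Finset.mem_univ i)]
  have := hb i
  field_simp

open Polynomial in
lemma coeff_prod_X_add_C {n j : ℕ} (hj : j ≤ n) (d : Fin n → ℝ) :
    (∏ i, (X + C (d i))).coeff (n - j) = esym n j d := by
  rw [Finset.prod_X_add_C_coeff _ _ (by simp), Finset.card_univ, Fintype.card_fin,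
    Nat.sub_sub_self hj, esym]

open Polynomial in
lemma coeff_prod_erase_X_add_C {n j : ℕ} (hj : j + 1 ≤ n) (d : Fin n → ℝ) (i : Fin n) :
    (∏ m ∈ Finset.univ.erase i, (X + C (d m))).coeff (n - (j + 1)) = esymRem n j d i := by
  have h : X * ∏ m ∈ Finset.univ.erase i, (X + C (d m))
      = ∏ m, (X + C (Function.update d i 0 m)) := by
    rw [← Finset.mul_prod_erase _ _ (Finset.mem_univ i)]
    congr 1
    · simp
    · refine Finset.prod_congr rfl fun m hm => ?_
      rw [Function.update_of_ne (Finset.ne_of_mem_erase hm)]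
  rw [esymRem, ← coeff_prod_X_add_C (by omega), ← h, show n - j = n - (j + 1) + 1 by omega,
    coeff_X_mul]

lemma isHermitian_diagonal_add_smul_vecMulVec {n : ℕ} (d v : Fin n → ℝ) (c : ℝ) :
    (Matrix.diagonal d + c • Matrix.vecMulVec v v).IsHermitian := by
  ext i j
  by_cases hij : i = j
  · simp [hij]
  · simp [hij, Ne.symm hij, Matrix.vecMulVec_apply, mul_comm]

open Polynomial in
lemma prod_X_add_C_eigs_diagonal_add {n : ℕ} (d v : Fin n → ℝ) (c : ℝ) (hd : ∀ i, 0 < d i) :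
    ∏ i, (X + C (eigs (Matrix.diagonal d + c • Matrix.vecMulVec v v) i))
      = ∏ i, (X + C (d i))
        + C c * ∑ i, C (v i ^ 2) * ∏ j ∈ Finset.univ.erase i, (X + C (d j)) := by
  refine Polynomial.eq_of_infinite_eval_eq _ _ ((Set.Ioi_infinite (0 : ℝ)).mono fun t ht => ?_)
  have ht : 0 < t := ht
  have h := det_diagonal_add_smul_vecMulVec (fun i => t + d i) v c
    fun i => (add_pos ht (hd i)).ne'
  rw [← Matrix.diagonal_add, add_assoc,
    ← prod_add_eigs (isHermitian_diagonal_add_smul_vecMulVec d v c)] at h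
  simpa [eval_prod, eval_finsetSum] using h

/-- Elementary symmetric functions of the eigenvalues of a rank-one perturbation of a positive
diagonal matrix. -/
lemma esym_eigs_diagonal_add {n j : ℕ} (hj : j + 1 ≤ n) (d v : Fin n → ℝ) (c : ℝ)
    (hd : ∀ i, 0 < d i) :
    esym n (j + 1) (eigs (Matrix.diagonal d + c • Matrix.vecMulVec v v))
      = esym n (j + 1) d + c * ∑ i, v i ^ 2 * esymRem n j d i := by
  have h := congrArg (fun p => Polynomial.coeff p (n - (j + 1)))
    (prod_X_add_C_eigs_diagonal_add d v c hd)
  simpa only [Polynomial.coeff_add, Polynomial.coeff_C_mul, Polynomial.finsetSum_coeff,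
    coeff_prod_X_add_C hj, coeff_prod_erase_X_add_C hj] using h

lemma esym_zero (n : ℕ) (d : Fin n → ℝ) : esym n 0 d = 1 := by
  simp [esym]

lemma esym_smul (n j : ℕ) (c : ℝ) (d : Fin n → ℝ) : esym n j (c • d) = c ^ j * esym n j d := by
  rw [esym, esym, Finset.mul_sum]
  refine Finset.sum_congr rfl fun S hS => ?_
  simp [Finset.prod_mul_distrib, (Finset.mem_powersetCard.mp hS).2]

lemma esymRem_smul (n j : ℕ) (c : ℝ) (d : Fin n → ℝ) (i : Fin n) :
    esymRem n j (c • d) i = c ^ j * esymRem n j d i := by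
  rw [esymRem, esymRem, ← esym_smul]
  congr 1
  ext m
  by_cases hm : m = i
  · subst hm; simp
  · simp [hm]

lemma esym_nonneg {n j : ℕ} {d : Fin n → ℝ} (hd : ∀ i, 0 ≤ d i) : 0 ≤ esym n j d :=
  Finset.sum_nonneg fun _ _ => Finset.prod_nonneg fun i _ => hd i

lemma esym_pos {n j : ℕ} (hj : j ≤ n) {d : Fin n → ℝ} (hd : ∀ i, 0 < d i) : 0 < esym n j d :=
  Finset.sum_pos (fun _ _ => Finset.prod_pos fun i _ => hd i)
    (Finset.powersetCard_nonempty.mpr (by simpa only [Finset.card_univ, Fintype.card_fin] using hj))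

lemma esymRem_nonneg {n j : ℕ} {d : Fin n → ℝ} (hd : ∀ i, 0 ≤ d i) (i : Fin n) :
    0 ≤ esymRem n j d i := by
  refine esym_nonneg fun m => ?_
  by_cases hm : m = i
  · subst hm; simp
  · simpa [hm] using hd m

open Polynomial in
lemma esymRem_mul_div_le_Hk {n k : ℕ} (hk : 1 ≤ k) (hkn : k ≤ n) (a : Fin n → ℝ) (i : Fin n) :
    esymRem n (k - 1) a i * a i / esym n k a ≤ Hk n k (Matrix.diagonal a) := by
  have hM : (Matrix.diagonal a).IsHermitian := Matrix.isHermitian_diagonal a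
  set e := eigs (Matrix.diagonal a)
  have hsub : ∏ m, (X - C (e m)) = ∏ m, (X - C (a m)) := by
    rw [prod_X_sub_C_eigs hM, Matrix.charpoly_diagonal]
  have hadd : ∏ m, (X + C (e m)) = ∏ m, (X + C (a m)) := by
    refine Polynomial.funext fun t => ?_
    have h := prod_add_eigs hM t
    rw [Matrix.diagonal_add, Matrix.det_diagonal] at h
    simpa [eval_prod] using h
  obtain ⟨m, hm⟩ : ∃ m, e m = a i := by
    have h := congrArg (eval (a i)) hsub.symm
    rw [eval_prod, eval_prod, Finset.prod_eq_zero (Finset.mem_univ i) (by simp),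
      eq_comm, Finset.prod_eq_zero_iff] at h
    obtain ⟨m, -, hm⟩ := h
    exact ⟨m, (by simpa [sub_eq_zero] using hm : a i = e m).symm⟩
  have herase : ∏ j ∈ Finset.univ.erase m, (X + C (e j))
      = ∏ j ∈ Finset.univ.erase i, (X + C (a j)) := by
    rw [← Finset.mul_prod_erase _ _ (Finset.mem_univ m),
      ← Finset.mul_prod_erase _ _ (Finset.mem_univ i), hm] at hadd
    exact mul_left_cancel₀ (X_add_C_ne_zero (a i)) hadd
  have hk' : k - 1 + 1 ≤ n := by omega
  rw [← coeff_prod_X_add_C hkn, ← coeff_prod_erase_X_add_C hk', ← hadd, ← herase, ← hm,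
    coeff_prod_X_add_C hkn, coeff_prod_erase_X_add_C hk']
  exact le_ciSup (f := fun j => esymRem n (k - 1) e j * e j / esym n k e)
    (Set.finite_range _).bddAbove m

lemma quadForm_diagonal {n : ℕ} (a : Fin n → ℝ) (x : EuclideanSpace ℝ (Fin n)) :
    quadForm (Matrix.diagonal a) x = (1 / 2) * ∑ i, a i * x i ^ 2 := by
  simp only [quadForm, Matrix.diagonal_apply, ite_mul, zero_mul, Finset.sum_ite_eq,
    Finset.mem_univ, if_true]
  congr 1
  exact Finset.sum_congr rfl fun i _ => by ring

lemma hasFDerivAt_euclideanSpace_apply {n : ℕ} (i : Fin n) (x : EuclideanSpace ℝ (Fin n)) :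
    HasFDerivAt (fun y : EuclideanSpace ℝ (Fin n) => y i)
      (EuclideanSpace.proj (𝕜 := ℝ) i : EuclideanSpace ℝ (Fin n) →L[ℝ] ℝ) x :=
  (EuclideanSpace.proj (𝕜 := ℝ) i : EuclideanSpace ℝ (Fin n) →L[ℝ] ℝ).hasFDerivAt

lemma hasFDerivAt_quadForm_diagonal {n : ℕ} (a : Fin n → ℝ) (x : EuclideanSpace ℝ (Fin n)) :
    HasFDerivAt (quadForm (Matrix.diagonal a))
      (∑ i, (a i * x i) • (EuclideanSpace.proj (𝕜 := ℝ) i : EuclideanSpace ℝ (Fin n) →L[ℝ] ℝ))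
      x := by
  have h : HasFDerivAt (fun y : EuclideanSpace ℝ (Fin n) => (1 / 2) * ∑ i, a i * y i ^ 2) _ x :=
    (HasFDerivAt.fun_sum fun i _ =>
      (((hasFDerivAt_euclideanSpace_apply i x).pow 2).const_mul (a i))).const_mul (1 / 2 : ℝ)
  rw [funext (quadForm_diagonal a)]
  convert! h using 1
  ext y
  simp only [sum_apply, smul_apply, smul_eq_mul,
    Finset.mul_sum]
  refine Finset.sum_congr rfl fun i _ => ?_
  simp
  ring

lemma sum_proj_single {n : ℕ} (b : Fin n → ℝ) (j : Fin n) :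
    (∑ i, b i • (EuclideanSpace.proj (𝕜 := ℝ) i : EuclideanSpace ℝ (Fin n) →L[ℝ] ℝ))
      (EuclideanSpace.single j 1) = b j := by
  simp

/-- The Hessian of `f(½xᵀAx)` for diagonal `A`. -/
lemma hessianMatrix_comp_quadForm_diagonal {n : ℕ} (a : Fin n → ℝ) {f : ℝ → ℝ}
    (hf : ContDiff ℝ 2 f) (x : EuclideanSpace ℝ (Fin n)) :
    hessianMatrix (fun y => f (quadForm (Matrix.diagonal a) y)) x
      = Matrix.diagonal (deriv f (quadForm (Matrix.diagonal a) x) • a)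
        + deriv (deriv f) (quadForm (Matrix.diagonal a) x)
          • Matrix.vecMulVec (fun i => a i * x i) (fun i => a i * x i) := by
  have hf1 : Differentiable ℝ f := hf.differentiable (by norm_num)
  have hf2 : Differentiable ℝ (deriv f) :=
    (hf.iterate_deriv' 1 1).differentiable (by norm_num)
  ext i j
  have hgrad : (fun y => fderiv ℝ (fun z => f (quadForm (Matrix.diagonal a) z)) y
        (EuclideanSpace.single j 1))
      = fun y => deriv f (quadForm (Matrix.diagonal a) y) * (a j * y j) := by
    funext y
    have hy := (hf1 _).hasDerivAt.comp_hasFDerivAt y (hasFDerivAt_quadForm_diagonal a y)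
    refine (congrArg (fun L => L (EuclideanSpace.single j 1)) hy.fderiv).trans ?_
    rw [smul_apply, sum_proj_single, smul_eq_mul]
  have h := ((hf2 _).hasDerivAt.comp_hasFDerivAt x (hasFDerivAt_quadForm_diagonal a x)).mul
    ((hasFDerivAt_euclideanSpace_apply j x).const_mul (a j))
  rw [hessianMatrix, hgrad]
  refine (congrArg (fun L => L (EuclideanSpace.single i 1)) h.fderiv).trans ?_
  simp only [add_apply, smul_apply, sum_proj_single,
    smul_eq_mul, Matrix.add_apply, Matrix.smul_apply, Matrix.vecMulVec_apply,
    Matrix.diagonal_apply, Function.comp_apply, Pi.smul_apply]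
  by_cases hij : i = j
  · subst hij; simp; ring
  · simp [hij, Ne.symm hij]; ring

/-- **Inequality (2.5) / `G-eq:S-D2w-sub`**: for a generalized symmetric function
`w(x) = f(½xᵀAx)` with diagonal positive definite `A = diag(a)` satisfying
`σ_k(a) = σ_l(a)`, if `f'(s) > 0`, `f''(s) ≤ 0`, `σ_k(λ(D²w)) ≥ 0` and
`σ_l(λ(D²w)) > 0` at `x`, then
`S_{k,l}(D²w) ≥ (f')^{k-l} + 2 H_k(A) f'' (f')^{k-l-1} s`. -/
theorem gsym_quotient_lower_bound
    (n k l : ℕ) (hn : 3 ≤ n) (hlk : l < k) (hkn : k ≤ n)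
    (a : Fin n → ℝ) (hapos : ∀ i, 0 < a i)
    (heq : esym n k a = esym n l a)
    (f : ℝ → ℝ) (hf : ContDiff ℝ 2 f)
    (w : EuclideanSpace ℝ (Fin n) → ℝ)
    (hw : ∀ y, w y = f (quadForm (Matrix.diagonal a) y))
    (x : EuclideanSpace ℝ (Fin n))
    (hf' : 0 < deriv f (quadForm (Matrix.diagonal a) x))
    (hf'' : deriv (deriv f) (quadForm (Matrix.diagonal a) x) ≤ 0)
    (hsk : 0 ≤ esym n k (eigs (hessianMatrix w x)))
    (hsl : 0 < esym n l (eigs (hessianMatrix w x))) :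
    (deriv f (quadForm (Matrix.diagonal a) x)) ^ (k - l) +
        2 * Hk n k (Matrix.diagonal a) *
          deriv (deriv f) (quadForm (Matrix.diagonal a) x) *
          (deriv f (quadForm (Matrix.diagonal a) x)) ^ (k - l - 1) *
          quadForm (Matrix.diagonal a) x
      ≤ Skl n k l (hessianMatrix w x) := by
  obtain rfl : w = fun y => f (quadForm (Matrix.diagonal a) y) := funext hw
  unfold Skl
  rw [hessianMatrix_comp_quadForm_diagonal a hf x] at hsk hsl ⊢
  set s := quadForm (Matrix.diagonal a) x with hs
  set p := deriv f s
  set q := deriv (deriv f) s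
  set v : Fin n → ℝ := fun i => a i * x i
  set M := Matrix.diagonal (p • a) + q • Matrix.vecMulVec v v
  have hpa : ∀ i, 0 < (p • a) i := fun i => mul_pos hf' (hapos i)
  have hexpand : ∀ j, j + 1 ≤ n → esym n (j + 1) (eigs M)
      = p ^ (j + 1) * esym n (j + 1) a + q * p ^ j * ∑ i, v i ^ 2 * esymRem n j a i := by
    intro j hj
    rw [esym_eigs_diagonal_add hj _ v q hpa, esym_smul, mul_assoc q, Finset.mul_sum (a := p ^ j)]
    congr 2
    exact Finset.sum_congr rfl fun i _ => by rw [esymRem_smul]; ring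
  have hsum : ∀ j, 0 ≤ ∑ i, v i ^ 2 * esymRem n j a i := fun j =>
    Finset.sum_nonneg fun i _ => mul_nonneg (sq_nonneg _) (esymRem_nonneg (fun m => (hapos m).le) i)
  have hl : esym n l (eigs M) ≤ p ^ l * esym n l a := by
    rcases l with _ | l
    · simp [esym_zero]
    · rw [hexpand l (by omega)]
      have := mul_nonneg (pow_nonneg hf'.le l) (hsum l)
      nlinarith
  obtain ⟨k, rfl⟩ : ∃ m, k = m + 1 := ⟨k - 1, by omega⟩
  have hσ : 0 < esym n (k + 1) a := esym_pos hkn hapos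
  have hH : ∑ i, v i ^ 2 * esymRem n k a i
      ≤ 2 * s * Hk n (k + 1) (Matrix.diagonal a) * esym n (k + 1) a := by
    rw [hs, quadForm_diagonal, ← mul_assoc, mul_one_div_cancel two_ne_zero, one_mul,
      Finset.sum_mul, Finset.sum_mul]
    refine Finset.sum_le_sum fun i _ => ?_
    have h := (div_le_iff₀ hσ).mp (esymRem_mul_div_le_Hk (by omega) hkn a i)
    have h' := mul_le_mul_of_nonneg_left h (mul_nonneg (hapos i).le (sq_nonneg (x i)))
    calc v i ^ 2 * esymRem n k a i = a i * x i ^ 2 * (esymRem n k a i * a i) := by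
          simp only [v]; ring
      _ ≤ _ := by simpa [mul_assoc] using h'
  have hk : (p ^ (k + 1) + q * p ^ k * (2 * s * Hk n (k + 1) (Matrix.diagonal a)))
      * esym n (k + 1) a ≤ esym n (k + 1) (eigs M) := by
    rw [hexpand k hkn]
    have := mul_le_mul_of_nonpos_left hH (mul_nonpos_of_nonpos_of_nonneg hf'' (pow_nonneg hf'.le k))
    linarith
  have hden : 0 < p ^ l * esym n (k + 1) a := mul_pos (pow_pos hf' l) hσ
  refine le_trans ?_ (div_le_div_of_nonneg_left hsk hsl (heq ▸ hl))
  rw [le_div_iff₀ hden]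
  refine le_trans (le_of_eq ?_) hk
  rw [show k + 1 - l = (k - l) + 1 by omega, Nat.add_sub_cancel]
  obtain ⟨m, rfl⟩ : ∃ m, k = l + m := ⟨k - l, by omega⟩
  rw [Nat.add_sub_cancel_left]
  ring
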